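/- arXiv:2011.08897 — 2 statements merged into one kernel-verified Lean document; each statement's English description precedes it below -/
import Mathlib

section
/- Let L be a frame, S a D-sublocale of L and T an arbitrary sublocale of L. Then the difference S ∖ T (the least sublocale R of L with S ⊆ T ∨ R, which exists because S(L) is a coframe) is a D-sublocale of L. -/
open Set

universe u

namespace TD

variable {L : Type u} [Order.Frame L]

/-- A sublocale of a frame `L`: a subset closed under arbitrary meets and
under `a ⇨ -` for every `a : L`. -/
def IsSublocale (S : Set L) : Prop :=
  (∀ A : Set L, A ⊆ S → sInf A ∈ S) ∧ ∀ a : L, ∀ s ∈ S, (a ⇨ s) ∈ S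

/-- The covered primes of the (sub)frame `S` (meets computed in `L`,
which agree with meets in `S` when `S` is a sublocale).  The covered primes
of `L` itself are `ptD (Set.univ)`. -/
def ptD (S : Set L) : Set L :=
  {p | p ∈ S ∧ p ≠ ⊤ ∧ ∀ A : Set L, A ⊆ S → sInf A = p → p ∈ A}

/-- The primes of the (sub)frame `S`.  The primes of `L` itself are
`pt (Set.univ)`. -/
def pt (S : Set L) : Set L :=
  {p | p ∈ S ∧ p ≠ ⊤ ∧ ∀ x ∈ S, ∀ y ∈ S, p = x ⊓ y → p = x ∨ p = y}

/-- A D-sublocale: a sublocale all of whose covered primes are covered primes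
of the ambient frame `L`. -/
def IsDSublocale (S : Set L) : Prop :=
  IsSublocale S ∧ ptD S ⊆ ptD (univ : Set L)

/-- The join, computed in the coframe `S(L)` of all sublocales, of a family of
subsets of `L`: all meets of subsets of the union. -/
def sJoin (𝒮 : Set (Set L)) : Set L :=
  {x | ∃ A : Set L, A ⊆ ⋃₀ 𝒮 ∧ sInf A = x}

/-- Binary join in `S(L)`. -/
def join2 (S T : Set L) : Set L := sJoin {S, T}

/-- The closed sublocale `c(a) = ↑a`. -/
def closedSub (a : L) : Set L := Ici a

/-- The open sublocale `o(a) = {a ⇨ b | b ∈ L}`. -/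
def openSub (a : L) : Set L := {x | ∃ b : L, x = a ⇨ b}

/-- The Boolean sublocale `b(a) = {x ⇨ a | x ∈ L}`. -/
def bSub (a : L) : Set L := {x | ∃ y : L, x = y ⇨ a}

/-- A complemented sublocale: one having a complement in the coframe `S(L)`
(whose bottom is `{⊤}` and top is `L` itself, i.e. `Set.univ`). -/
def IsComplementedSublocale (C : Set L) : Prop :=
  IsSublocale C ∧ ∃ C' : Set L, IsSublocale C' ∧ C ∩ C' = {⊤} ∧ join2 C C' = univ

/-- A smooth sublocale: a join in `S(L)` of complemented sublocales. -/
def IsSmooth (S : Set L) : Prop :=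
  ∃ 𝒞 : Set (Set L), (∀ C ∈ 𝒞, IsComplementedSublocale C) ∧ S = sJoin 𝒞

/-- `M Y`: the closure of `Y` under arbitrary meets (with `⋀ ∅ = ⊤`). -/
def M (Y : Set L) : Set L := {x | ∃ A : Set L, A ⊆ Y ∧ sInf A = x}

/-- The (sub)frame `S` is `T_D`-spatial: every element of `S` is a meet of
covered primes of `S`. -/
def IsTDSpatialSub (S : Set L) : Prop :=
  ∀ s ∈ S, ∃ P : Set L, P ⊆ ptD S ∧ sInf P = s

/-- The (sub)frame `S` is spatial: every element of `S` is a meet of primes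
of `S`. -/
def IsSpatialSub (S : Set L) : Prop :=
  ∀ s ∈ S, ∃ P : Set L, P ⊆ pt S ∧ sInf P = s

/-- The primes of `L` lying above `a`, i.e. `pt(↑a)`. -/
def ptAbove (a : L) : Set L := {p | p ∈ pt (univ : Set L) ∧ a ≤ p}

/-- A prime of the frame `S_D(L)^op` (order-reversed coframe of D-sublocales):
a D-sublocale `P ≠ {⊤}` such that `P = S₁ ∨ S₂` (join in `S(L)`) with
`S₁, S₂` D-sublocales implies `P = S₁` or `P = S₂`. -/
def PrimeInSDop (P : Set L) : Prop :=
  IsDSublocale P ∧ P ≠ ({⊤} : Set L) ∧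
    ∀ S₁ S₂ : Set L, IsDSublocale S₁ → IsDSublocale S₂ →
      P = join2 S₁ S₂ → P = S₁ ∨ P = S₂

/-- A covered prime of the frame `S_D(L)^op`: a D-sublocale `P ≠ {⊤}` such
that whenever `P` is a join of a family of D-sublocales, it equals one of
them. -/
def CovPrimeInSDop (P : Set L) : Prop :=
  IsDSublocale P ∧ P ≠ ({⊤} : Set L) ∧
    ∀ 𝒮 : Set (Set L), (∀ T ∈ 𝒮, IsDSublocale T) → P = sJoin 𝒮 → ∃ T ∈ 𝒮, P = T

/-- A prime of the frame `S(L)^op`. -/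
def PrimeInSop (P : Set L) : Prop :=
  IsSublocale P ∧ P ≠ ({⊤} : Set L) ∧
    ∀ S₁ S₂ : Set L, IsSublocale S₁ → IsSublocale S₂ →
      P = join2 S₁ S₂ → P = S₁ ∨ P = S₂

/-- A prime of the frame `S_b(L)^op` of smooth sublocales. -/
def PrimeInSbop (P : Set L) : Prop :=
  IsSmooth P ∧ P ≠ ({⊤} : Set L) ∧
    ∀ S₁ S₂ : Set L, IsSmooth S₁ → IsSmooth S₂ →
      P = join2 S₁ S₂ → P = S₁ ∨ P = S₂

/-- A prime element of a complete lattice. -/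
def IsPrimeElt {α : Type*} [CompleteLattice α] (p : α) : Prop :=
  p ≠ ⊤ ∧ ∀ x y : α, p = x ⊓ y → p = x ∨ p = y

/-- A `T_D` topological space: `T₀` and every point has an open
neighbourhood `U` with `U \ {x}` open. -/
def IsTDSpace (X : Type*) [TopologicalSpace X] : Prop :=
  T0Space X ∧ ∀ x : X, ∃ U : Set X, IsOpen U ∧ x ∈ U ∧ IsOpen (U \ {x})

/-- A sober space: every prime of the frame of opens is of the form
`X ∖ cl {x}` for a unique point `x`. -/
def IsSoberSpace (X : Type*) [TopologicalSpace X] : Prop :=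
  ∀ p : TopologicalSpace.Opens X, IsPrimeElt p →
    ∃! x : X, p = ⟨(closure {x})ᶜ, isClosed_closure.isOpen_compl⟩


theorem subset_join2_left (S T : Set L) : S ⊆ join2 S T := fun x hx =>
  ⟨{x}, by simpa [sUnion_pair] using Or.inl hx, sInf_singleton⟩

theorem subset_join2_right (S T : Set L) : T ⊆ join2 S T := fun x hx =>
  ⟨{x}, by simpa [sUnion_pair] using Or.inr hx, sInf_singleton⟩

theorem sInf_mem_sJoin {𝒮 : Set (Set L)} {A : Set L} (hA : A ⊆ sJoin 𝒮) :
    sInf A ∈ sJoin 𝒮 := by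
  refine ⟨{y | y ∈ ⋃₀ 𝒮 ∧ sInf A ≤ y}, fun y hy => hy.1, le_antisymm ?_ ?_⟩
  · refine le_sInf fun x hx => ?_
    obtain ⟨B, hB, rfl⟩ := hA hx
    exact le_sInf fun y hy => sInf_le ⟨hB hy, (sInf_le hx).trans (sInf_le hy)⟩
  · exact le_sInf fun y hy => hy.2

/-- The elements of `R` that do not generate `p` under Heyting implication. If `p` is a covered
prime of `R`, this is the complement of `{p, ⊤}` in `R`. -/
def avoiding (R : Set L) (p : L) : Set L := {x | x ∈ R ∧ ∀ a : L, a ⇨ x ≠ p}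

theorem himp_sInf (a : L) (A : Set L) : a ⇨ sInf A = sInf ((a ⇨ ·) '' A) :=
  eq_of_forall_le_iff fun c => by simp [le_sInf_iff, le_himp_iff]

theorem isSublocale_avoiding {R : Set L} {p : L} (hR : IsSublocale R) (hp : p ∈ ptD R) :
    IsSublocale (avoiding R p) := by
  refine ⟨fun A hA => ⟨hR.1 A fun x hx => (hA hx).1, fun a ha => ?_⟩,
    fun a s hs => ⟨hR.2 a s hs.1, fun b hb => hs.2 (b ⊓ a) ?_⟩⟩
  · rw [himp_sInf] at ha
    obtain ⟨x, hx, hxp⟩ := hp.2.2 _ (image_subset_iff.2 fun x hx => hR.2 a x (hA hx).1) ha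
    exact (hA hx).2 a hxp
  · rwa [← himp_himp]

theorem mem_avoiding_of_not_le {R : Set L} {p x : L} (hx : x ∈ R) (hxp : ¬ x ≤ p) :
    x ∈ avoiding R p :=
  ⟨hx, fun _ h => hxp (h ▸ le_himp)⟩

theorem himp_mem_avoiding {R : Set L} {p x : L} (hR : IsSublocale R) (hp : p ≠ ⊤)
    (hx : x ∈ R) : p ⇨ x ∈ avoiding R p := by
  refine ⟨hR.2 p x hx, fun a ha => hp ?_⟩
  have h : p ⇨ (a ⇨ (p ⇨ x)) = a ⇨ (p ⇨ x) := by
    simp only [himp_himp]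
    rw [inf_eq_right.2 inf_le_right]
  rw [ha, himp_self] at h
  exact h.symm

theorem subset_join2_avoiding {R : Set L} {p : L} (hR : IsSublocale R) (hp : p ≠ ⊤) :
    R ⊆ join2 {p} (avoiding R p) := fun r hr => by
  by_cases h : ∀ a : L, a ⇨ r ≠ p
  · exact subset_join2_right _ _ ⟨hr, h⟩
  · push Not at h
    obtain ⟨a, ha⟩ := h
    have hrp : r = sInf {p, p ⇨ r} := by
      rw [sInf_pair, inf_himp, inf_eq_right.2 (ha ▸ le_himp)]
    rw [hrp]
    refine sInf_mem_sJoin (pair_subset ?_ ?_)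
    · exact subset_join2_left _ _ rfl
    · exact subset_join2_right _ _ (himp_mem_avoiding hR hp hr)

theorem join2_subset {S T : Set L} {𝒮 : Set (Set L)} (hS : S ⊆ sJoin 𝒮) (hT : T ⊆ sJoin 𝒮) :
    join2 S T ⊆ sJoin 𝒮 := by
  rintro _ ⟨A, hA, rfl⟩
  refine sInf_mem_sJoin (hA.trans ?_)
  rw [sUnion_pair]
  exact union_subset hS hT

/-- A covered prime of `S ∖ T` is a covered prime of `S`. -/
theorem ptD_diff_subset {S T R : Set L} (hS : IsSublocale S)
    (hR : IsSublocale R) (hSTR : S ⊆ join2 T R)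
    (hleast : ∀ R' : Set L, IsSublocale R' → S ⊆ join2 T R' → R ⊆ R') :
    ptD R ⊆ ptD S := by
  intro p hp
  refine ⟨hleast S hS (subset_join2_right T S) hp.1, hp.2.1, fun A hA hAp => ?_⟩
  by_contra hpA
  have hpJ : p ∈ join2 T (avoiding R p) := by
    suffices h : sInf A ∈ join2 T (avoiding R p) by rwa [hAp] at h
    refine sInf_mem_sJoin fun x hx => ?_
    have hxp : ¬ x ≤ p := fun h =>
      hpA (le_antisymm h (hAp ▸ sInf_le hx) ▸ hx)
    obtain ⟨B, hB, rfl⟩ := hSTR (hA hx)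
    refine sInf_mem_sJoin fun y hy => ?_
    rw [sUnion_pair] at hB
    rcases hB hy with hyT | hyR
    · exact subset_join2_left _ _ hyT
    · exact subset_join2_right _ _
        (mem_avoiding_of_not_le hyR fun h => hxp ((sInf_le hy).trans h))
  have hRJ : R ⊆ join2 T (avoiding R p) := (subset_join2_avoiding hR hp.2.1).trans
    (join2_subset (singleton_subset_iff.2 hpJ) (subset_join2_right _ _))
  have hpC : p ∈ avoiding R p := hleast _ (isSublocale_avoiding hR hp)
    (hSTR.trans (join2_subset (subset_join2_left _ _) hRJ)) hp.1
  exact hpC.2 ⊤ top_himp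

/-- the difference `S ∖ T` (the least sublocale `R` with
`S ⊆ T ∨ R`) of a D-sublocale `S` and an arbitrary sublocale `T` is a
D-sublocale. -/
theorem diff_isDSublocale (S T R : Set L)
    (hS : IsDSublocale S) (hT : IsSublocale T)
    (hR : IsSublocale R) (hSTR : S ⊆ join2 T R)
    (hleast : ∀ R' : Set L, IsSublocale R' → S ⊆ join2 T R' → R ⊆ R') :
    IsDSublocale R := by
  exact ⟨hR, (ptD_diff_subset hS.1 hR hSTR hleast).trans hS.2⟩

end TD
end

section
/- Let L be a frame. Every prime of the frame S_D(L)^op is covered: if S ∈ S_D(L) with S ≠ {1} is such that S = S₁ ∨ S₂ (join in S(L)) with S₁, S₂ ∈ S_D(L) implies S = S₁ or S = S₂, then for every family {S_i}_{i∈I} ⊆ S_D(L) with S = ⋁_i S_i there exists i with S = S_i; equivalently, such an S is of the form {1, p} for some covered prime p ∈ pt_D(L). -/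
open Set

universe u

namespace TD

variable {L : Type u} [Order.Frame L]

theorem IsSublocale.inter_Ici {S : Set L} (hS : IsSublocale S) (a : L) :
    IsSublocale (S ∩ Ici a) :=
  ⟨fun A hA => ⟨hS.1 A fun _ hx => (hA hx).1, le_sInf fun _ hx => (hA hx).2⟩,
    fun b s hs => ⟨hS.2 b s hs.1, le_trans hs.2 le_himp⟩⟩

theorem IsSublocale.inter_himp_fixed {S : Set L} (hS : IsSublocale S) (a : L) :
    IsSublocale (S ∩ {x | a ⇨ x = x}) := by
  refine ⟨fun A hA => ⟨hS.1 A fun _ hx => (hA hx).1, ?_⟩, fun b s hs => ⟨hS.2 b s hs.1, ?_⟩⟩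
  · refine le_antisymm (le_sInf fun x hx => ?_) le_himp
    exact (himp_le_himp_left (sInf_le hx)).trans (hA hx).2.le
  · have h : a ⇨ s = s := hs.2
    rw [mem_ofPred_eq, himp_left_comm, h]

theorem IsDSublocale.inter_Ici {S : Set L} (hS : IsDSublocale S) (a : L) :
    IsDSublocale (S ∩ Ici a) := by
  refine ⟨hS.1.inter_Ici a, fun p ⟨hp, hpt, hcov⟩ => hS.2 ⟨hp.1, hpt, fun A hA hAp => ?_⟩⟩
  exact hcov A (fun x hx => ⟨hA hx, le_trans hp.2 (hAp ▸ sInf_le hx)⟩) hAp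

theorem IsDSublocale.inter_himp_fixed {S : Set L} (hS : IsDSublocale S) (a : L) :
    IsDSublocale (S ∩ {x | a ⇨ x = x}) := by
  refine ⟨hS.1.inter_himp_fixed a,
    fun p ⟨hp, hpt, hcov⟩ => hS.2 ⟨hp.1, hpt, fun A hA hAp => ?_⟩⟩
  have hap : a ⇨ p = p := hp.2
  have hmem : p ∈ (a ⇨ ·) '' A := by
    refine hcov _ ?_ (le_antisymm ?_ ?_)
    · rintro _ ⟨x, hx, rfl⟩
      exact ⟨hS.1.2 a x (hA hx), himp_idem⟩
    · rw [← hap, le_himp_iff, ← hAp]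
      refine le_sInf fun x hx => le_himp_iff.1 (sInf_le (mem_image_of_mem _ hx))
    · refine le_sInf ?_
      rintro _ ⟨x, hx, rfl⟩
      exact (hAp ▸ sInf_le hx : p ≤ x).trans le_himp
  obtain ⟨x, hx, hxp⟩ := hmem
  have hxle : x ≤ p := hxp ▸ le_himp
  rwa [← le_antisymm hxle (hAp ▸ sInf_le hx)]

theorem subset_sJoin {𝒮 : Set (Set L)} {T : Set L} (hT : T ∈ 𝒮) : T ⊆ sJoin 𝒮 :=
  fun x hx => ⟨{x}, singleton_subset_iff.2 ⟨T, hT, hx⟩, sInf_singleton⟩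

theorem IsSublocale.top_mem {S : Set L} (hS : IsSublocale S) : ⊤ ∈ S :=
  sInf_empty (α := L) ▸ hS.1 ∅ (empty_subset S)

/-- A sublocale is the join of its traces on the closed and the open sublocale of `a`. -/
theorem IsSublocale.eq_join2 {S : Set L} (hS : IsSublocale S) (a : L) :
    S = join2 (S ∩ Ici a) (S ∩ {x | a ⇨ x = x}) := by
  refine Subset.antisymm (fun s hs => ?_) ?_
  · refine ⟨{(a ⇨ s) ⇨ s, a ⇨ s}, ?_, ?_⟩
    · rintro x (rfl | rfl)
      · exact ⟨_, Or.inl rfl, hS.2 _ s hs, le_himp_himp⟩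
      · exact ⟨_, Or.inr rfl, hS.2 _ s hs, himp_idem⟩
    · rw [sInf_pair, himp_inf_self, inf_eq_left]
      exact le_himp
  · rintro _ ⟨A, hA, rfl⟩
    refine hS.1 A fun x hx => ?_
    obtain ⟨T, rfl | rfl, hxT⟩ := hA hx
    exacts [hxT.1, hxT.1]

/-- every prime of the frame `S_D(L)^op` is covered: if
`S ∈ S_D(L)`, `S ≠ {⊤}`, and `S = S₁ ∨ S₂` with D-sublocales `S₁, S₂`
implies `S = S₁` or `S = S₂`, then `S` equals a member of every family of
D-sublocales whose join it is; equivalently `S = {⊤, p}` for some covered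
prime `p` of `L`. -/
theorem prime_SDop_covered (S : Set L) (hS : IsDSublocale S)
    (hne : S ≠ ({⊤} : Set L))
    (hprime : ∀ S₁ S₂ : Set L, IsDSublocale S₁ → IsDSublocale S₂ →
      S = join2 S₁ S₂ → S = S₁ ∨ S = S₂) :
    (∀ 𝒮 : Set (Set L), (∀ T ∈ 𝒮, IsDSublocale T) → S = sJoin 𝒮 →
      ∃ T ∈ 𝒮, S = T) ∧
    ∃ p ∈ ptD (univ : Set L), S = ({⊤, p} : Set L) := by
  obtain ⟨m, hmS, hle⟩ : ∃ m ∈ S, ∀ x ∈ S, m ≤ x :=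
    ⟨sInf S, hS.1.1 S Subset.rfl, fun x hx => sInf_le hx⟩
  have hmem : ∀ a ∈ S, a = ⊤ ∨ a = m := by
    intro a ha
    rcases hprime _ _ (hS.inter_Ici a) (hS.inter_himp_fixed a) (hS.1.eq_join2 a) with h | h
    · rw [h] at hmS
      exact Or.inr (le_antisymm hmS.2 (hle a ha))
    · rw [h] at ha
      have haa : a ⇨ a = a := ha.2
      exact Or.inl (haa.symm.trans himp_self)
  have hSeq : S = {⊤, m} := by
    refine Subset.antisymm (fun a ha => hmem a ha) ?_
    rintro x (rfl | rfl)
    exacts [hS.1.top_mem, hmS]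
  have hmt : m ≠ ⊤ := by
    rintro rfl
    exact hne (by rw [hSeq, pair_eq_singleton])
  have hcov : ∀ A : Set L, A ⊆ S → sInf A = m → m ∈ A := by
    intro A hA hAm
    by_contra hmA
    refine hmt (hAm ▸ sInf_eq_top.2 fun x hx => (hmem x (hA hx)).resolve_right ?_)
    rintro rfl
    exact hmA hx
  refine ⟨fun 𝒮 h𝒮 hj => ?_, m, hS.2 ⟨hmS, hmt, hcov⟩, hSeq⟩
  have hsub : ∀ T ∈ 𝒮, T ⊆ S := fun T hT => hj ▸ subset_sJoin hT
  obtain ⟨A, hA, hAm⟩ : m ∈ sJoin 𝒮 := hj ▸ hmS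
  obtain ⟨T, hT, hmT⟩ := hA (hcov A (hA.trans (sUnion_subset hsub)) hAm)
  refine ⟨T, hT, Subset.antisymm ?_ (hsub T hT)⟩
  rw [hSeq]
  rintro x (rfl | rfl)
  exacts [(h𝒮 T hT).1.top_mem, hmT]

end TD
end
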